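/- Let M be a commutative semiring-valued functor on finite étale covers with transfers and norms satisfying the base-change and distributivity axioms (a naive motivic Tambara functor). Then for any finite étale morphism g : X → Y, the projection formula holds: for all a ∈ M(X) and b ∈ M(Y), tr_g(a · g*(b)) = tr_g(a) · b. -/

import Mathlib

/-!
STATEMENT 5: For a naive motivic Tambara functor `M` (a commutative
semiring-valued sheaf on finite étale covers with pullbacks, transfers and
norms satisfying the base-change and distributivity axioms), and any finite
étale morphism `g : X ⟶ Y`, the projection formula holds:
`tr_g (a * g^* b) = tr_g a * b`.

We formalize the setting abstractly: `C` is a category (modelling the category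
`FEt_k` of finite étale schemes over a connected base, in which *every*
morphism is finite étale) with pullbacks and finite coproducts, and Weil
restrictions are specified by their universal property.
-/

open CategoryTheory Limits

universe v u

/-- The Weil restriction of `q : A ⟶ X` along `f : X ⟶ Y`, characterized by the
universal property `Hom_Y(T, R) ≃ {s : T ×_Y X ⟶ A over X}`. -/
structure WeilRestriction {C : Type u} [Category.{v} C] [HasPullbacks C]
    {X Y A : C} (f : X ⟶ Y) (q : A ⟶ X) where
  /-- the underlying object `R_f A` -/
  R : C
  /-- the structure morphism `R_f(q) : R_f A ⟶ Y` -/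
  Rq : R ⟶ Y
  /-- the counit `e : X ×_Y R_f A ⟶ A` -/
  e : pullback f Rq ⟶ A
  he : e ≫ q = pullback.fst f Rq
  /-- universal property -/
  univ : ∀ {T : C} (p : T ⟶ Y),
    Function.Bijective (fun u : {u : T ⟶ R // u ≫ Rq = p} =>
      (⟨pullback.lift (pullback.fst f p) (pullback.snd f p ≫ u.1)
          (by rw [Category.assoc, u.2, pullback.condition]) ≫ e,
        by rw [Category.assoc, he, pullback.lift_fst]⟩ :
        {s : pullback f p ⟶ A // s ≫ q = pullback.fst f p}))

/-- A naive motivic Tambara functor: a commutative-semiring-valued Nisnevich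
(= finite-coproduct) sheaf with functorial pullbacks `res`, additive transfers
`tr` and multiplicative norms `nm`, satisfying base change and distributivity. -/
structure NaiveTambaraFunctor (C : Type u) [Category.{v} C] [HasPullbacks C]
    [HasFiniteCoproducts C] where
  /-- the value semirings -/
  obj : C → CommSemiRingCat.{v}
  /-- contravariant functoriality (pullback), by semiring homomorphisms -/
  res : ∀ {X Y : C}, (X ⟶ Y) → (obj Y →+* obj X)
  /-- transfer (additive) -/
  tr : ∀ {X Y : C}, (X ⟶ Y) → (obj X →+ obj Y)
  /-- norm (multiplicative) -/
  nm : ∀ {X Y : C}, (X ⟶ Y) → (obj X →* obj Y)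
  res_id : ∀ X : C, res (𝟙 X) = RingHom.id (obj X)
  res_comp : ∀ {X Y Z : C} (f : X ⟶ Y) (g : Y ⟶ Z), res (f ≫ g) = (res f).comp (res g)
  tr_id : ∀ (X : C) (a : obj X), tr (𝟙 X) a = a
  tr_comp : ∀ {X Y Z : C} (f : X ⟶ Y) (g : Y ⟶ Z) (a : obj X), tr g (tr f a) = tr (f ≫ g) a
  nm_id : ∀ (X : C) (a : obj X), nm (𝟙 X) a = a
  nm_comp : ∀ {X Y Z : C} (f : X ⟶ Y) (g : Y ⟶ Z) (a : obj X), nm g (nm f a) = nm (f ≫ g) a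
  /-- base change for transfers -/
  tr_bc : ∀ {X Y Y' : C} (f : X ⟶ Y) (p : Y' ⟶ Y) (a : obj X),
    res p (tr f a) = tr (pullback.snd f p) (res (pullback.fst f p) a)
  /-- base change for norms -/
  nm_bc : ∀ {X Y Y' : C} (f : X ⟶ Y) (p : Y' ⟶ Y) (a : obj X),
    res p (nm f a) = nm (pullback.snd f p) (res (pullback.fst f p) a)
  /-- the sheaf condition for binary coproducts -/
  sheaf : ∀ X Y : C, Function.Bijective
    (fun m : obj (X ⨿ Y) => (res (coprod.inl : X ⟶ X ⨿ Y) m, res (coprod.inr : Y ⟶ X ⨿ Y) m))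
  /-- the semiring addition is the transfer along the fold map -/
  tr_fold : ∀ (X : C) (m : obj (X ⨿ X)),
    tr (coprod.desc (𝟙 X) (𝟙 X)) m =
      res (coprod.inl : X ⟶ X ⨿ X) m + res (coprod.inr : X ⟶ X ⨿ X) m
  /-- the semiring multiplication is the norm along the fold map -/
  nm_fold : ∀ (X : C) (m : obj (X ⨿ X)),
    nm (coprod.desc (𝟙 X) (𝟙 X)) m =
      res (coprod.inl : X ⟶ X ⨿ X) m * res (coprod.inr : X ⟶ X ⨿ X) m
  /-- the distributivity law, relative to any exponential diagram -/
  distrib : ∀ {A X Y : C} (q : A ⟶ X) (f : X ⟶ Y) (W : WeilRestriction f q) (a : obj A),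
    nm f (tr q a) = tr W.Rq (nm (pullback.snd f W.Rq) (res W.e a))

section LocalSimp

attribute [local simp] coprod.inl_desc coprod.inr_desc coprod.inl_desc_assoc coprod.inr_desc_assoc
  pullback.lift_fst pullback.lift_snd pullback.lift_fst_assoc pullback.lift_snd_assoc
  coprod.inl_map coprod.inr_map coprod.inl_map_assoc coprod.inr_map_assoc

section Helpers

variable {C : Type u} [Category.{v} C] [HasPullbacks C] [HasFiniteCoproducts C]

/-- Coproducts are stable under pullback, thanks to Weil restrictions. -/
lemma univ_coprod
    (hWeil : ∀ {X Y A : C} (f : X ⟶ Y) (q : A ⟶ X), Nonempty (WeilRestriction f q))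
    {X A B Y : C} (r : X ⟶ Y) (i : A ⟶ Y) (j : B ⟶ Y) [IsIso (coprod.desc i j)] :
    IsIso (coprod.desc (pullback.fst r i) (pullback.fst r j)) := by
  obtain ⟨p, hp⟩ : ∃ p : A ⨿ B ⟶ Y, p = coprod.desc i j := ⟨_, rfl⟩
  have hp1 : coprod.inl ≫ p = i := by rw [hp, coprod.inl_desc]
  have hp2 : coprod.inr ≫ p = j := by rw [hp, coprod.inr_desc]
  obtain ⟨ci, ci1, ci2⟩ : ∃ ci : pullback r i ⟶ pullback r p, ci ≫ pullback.fst r p =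
      pullback.fst r i ∧ ci ≫ pullback.snd r p = pullback.snd r i ≫ coprod.inl :=
    ⟨pullback.lift (pullback.fst r i) (pullback.snd r i ≫ coprod.inl)
      (by rw [Category.assoc, hp1, pullback.condition]),
      pullback.lift_fst _ _ _, pullback.lift_snd _ _ _⟩
  obtain ⟨cj, cj1, cj2⟩ : ∃ cj : pullback r j ⟶ pullback r p, cj ≫ pullback.fst r p =
      pullback.fst r j ∧ cj ≫ pullback.snd r p = pullback.snd r j ≫ coprod.inr :=
    ⟨pullback.lift (pullback.fst r j) (pullback.snd r j ≫ coprod.inr)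
      (by rw [Category.assoc, hp2, pullback.condition]),
      pullback.lift_fst _ _ _, pullback.lift_snd _ _ _⟩
  have lift_i : ∀ {R : C} (Rq : R ⟶ Y) (w : A ⨿ B ⟶ R) (h h'),
      ci ≫ pullback.lift (f := r) (g := Rq) (pullback.fst r p) (pullback.snd r p ≫ w) h =
      pullback.lift (pullback.fst r i) (pullback.snd r i ≫ coprod.inl ≫ w) h' := by
    intro R Rq w h h'
    apply pullback.hom_ext
    · rw [Category.assoc, pullback.lift_fst, pullback.lift_fst, ci1]
    · rw [Category.assoc, pullback.lift_snd, pullback.lift_snd, ← Category.assoc, ci2,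
        Category.assoc]
  have lift_j : ∀ {R : C} (Rq : R ⟶ Y) (w : A ⨿ B ⟶ R) (h h'),
      cj ≫ pullback.lift (f := r) (g := Rq) (pullback.fst r p) (pullback.snd r p ≫ w) h =
      pullback.lift (pullback.fst r j) (pullback.snd r j ≫ coprod.inr ≫ w) h' := by
    intro R Rq w h h'
    apply pullback.hom_ext
    · rw [Category.assoc, pullback.lift_fst, pullback.lift_fst, cj1]
    · rw [Category.assoc, pullback.lift_snd, pullback.lift_snd, ← Category.assoc, cj2,
        Category.assoc]
  -- a section
  have key : ∀ {E : C} (q : E ⟶ X) (si : pullback r i ⟶ E) (sj : pullback r j ⟶ E),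
      si ≫ q = pullback.fst r i → sj ≫ q = pullback.fst r j →
      ∃ s : pullback r p ⟶ E, s ≫ q = pullback.fst r p ∧ ci ≫ s = si ∧ cj ≫ s = sj := by
    intro E q si sj hi hj
    obtain ⟨W⟩ := hWeil r q
    obtain ⟨⟨ui, hui⟩, hui'⟩ := (W.univ i).2 ⟨si, hi⟩
    obtain ⟨⟨uj, huj⟩, huj'⟩ := (W.univ j).2 ⟨sj, hj⟩
    obtain ⟨w, hu1, hu2⟩ : ∃ w : A ⨿ B ⟶ W.R, coprod.inl ≫ w = ui ∧ coprod.inr ≫ w = uj :=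
      ⟨coprod.desc ui uj, coprod.inl_desc _ _, coprod.inr_desc _ _⟩
    have hu : w ≫ W.Rq = p := by
      apply coprod.hom_ext
      · rw [← Category.assoc, hu1, hui, hp1]
      · rw [← Category.assoc, hu2, huj, hp2]
    refine ⟨pullback.lift (pullback.fst r p) (pullback.snd r p ≫ w)
      (by rw [Category.assoc, hu, pullback.condition]) ≫ W.e, ?_, ?_, ?_⟩
    · rw [Category.assoc, W.he, pullback.lift_fst]
    · have := congrArg Subtype.val hui'
      simp only at this
      rw [← this, ← Category.assoc ci, lift_i W.Rq _ _ (by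
        rw [hu1, Category.assoc, hui, pullback.condition])]
      simp only [hu1]
    · have := congrArg Subtype.val huj'
      simp only at this
      rw [← this, ← Category.assoc cj, lift_j W.Rq _ _ (by
        rw [hu2, Category.assoc, huj, pullback.condition])]
      simp only [hu2]
  have uniq : ∀ {E : C} (q : E ⟶ X) (s s' : pullback r p ⟶ E),
      s ≫ q = pullback.fst r p → s' ≫ q = pullback.fst r p →
      ci ≫ s = ci ≫ s' → cj ≫ s = cj ≫ s' → s = s' := by
    intro E q s s' hs hs' h1 h2
    obtain ⟨W⟩ := hWeil r q
    obtain ⟨⟨w, hw⟩, hw1⟩ := (W.univ p).2 ⟨s, hs⟩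
    obtain ⟨⟨w', hw'⟩, hw1'⟩ := (W.univ p).2 ⟨s', hs'⟩
    have e1 := congrArg Subtype.val hw1
    have e1' := congrArg Subtype.val hw1'
    simp only at e1 e1'
    have hww : w = w' := by
      apply coprod.hom_ext
      · have q1 : (coprod.inl ≫ w) ≫ W.Rq = i := by rw [Category.assoc, hw, hp1]
        have q2 : (coprod.inl ≫ w') ≫ W.Rq = i := by rw [Category.assoc, hw', hp1]
        have := @(W.univ i).1 ⟨coprod.inl ≫ w, q1⟩ ⟨coprod.inl ≫ w', q2⟩
          (by
            apply Subtype.ext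
            rw [← e1, ← e1', ← Category.assoc ci, ← Category.assoc ci,
              lift_i W.Rq w _ (by rw [Category.assoc, q1, pullback.condition]),
              lift_i W.Rq w' _ (by rw [Category.assoc, q2, pullback.condition])] at h1
            exact h1)
        exact congrArg Subtype.val this
      · have q1 : (coprod.inr ≫ w) ≫ W.Rq = j := by rw [Category.assoc, hw, hp2]
        have q2 : (coprod.inr ≫ w') ≫ W.Rq = j := by rw [Category.assoc, hw', hp2]
        have := @(W.univ j).1 ⟨coprod.inr ≫ w, q1⟩ ⟨coprod.inr ≫ w', q2⟩
          (by
            apply Subtype.ext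
            rw [← e1, ← e1', ← Category.assoc cj, ← Category.assoc cj,
              lift_j W.Rq w _ (by rw [Category.assoc, q1, pullback.condition]),
              lift_j W.Rq w' _ (by rw [Category.assoc, q2, pullback.condition])] at h2
            exact h2)
        exact congrArg Subtype.val this
    subst hww
    rw [← e1, ← e1']
  obtain ⟨s, hs, hs1, hs2⟩ := key (coprod.desc (pullback.fst r i) (pullback.fst r j))
    coprod.inl coprod.inr (coprod.inl_desc _ _) (coprod.inr_desc _ _)
  obtain ⟨c, hc1, hc2⟩ : ∃ c : pullback r i ⨿ pullback r j ⟶ pullback r p,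
      coprod.inl ≫ c = ci ∧ coprod.inr ≫ c = cj :=
    ⟨coprod.desc ci cj, coprod.inl_desc _ _, coprod.inr_desc _ _⟩
  have hc : c ≫ pullback.fst r p = coprod.desc (pullback.fst r i) (pullback.fst r j) := by
    apply coprod.hom_ext
    · rw [← Category.assoc, hc1, ci1, coprod.inl_desc]
    · rw [← Category.assoc, hc2, cj1, coprod.inr_desc]
  have hcs : c ≫ s = 𝟙 _ := by
    apply coprod.hom_ext
    · rw [← Category.assoc, hc1, hs1, Category.comp_id]
    · rw [← Category.assoc, hc2, hs2, Category.comp_id]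
  have hsc : s ≫ c = 𝟙 _ := by
    apply uniq (pullback.fst r p)
    · rw [Category.assoc, hc, hs]
    · rw [Category.id_comp]
    · rw [← Category.assoc, hs1, hc1, Category.comp_id]
    · rw [← Category.assoc, hs2, hc2, Category.comp_id]
  have : IsIso c := ⟨s, hcs, hsc⟩
  have : IsIso p := by rw [hp]; assumption
  rw [← hc]
  infer_instance

lemma mono_coproj
    (hWeil : ∀ {X Y A : C} (f : X ⟶ Y) (q : A ⟶ X), Nonempty (WeilRestriction f q))
    {A B Y : C} (i : A ⟶ Y) (j : B ⟶ Y) [IsIso (coprod.desc i j)] : Mono i := by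
  have := univ_coprod hWeil i i j
  let d : A ⟶ pullback i i := pullback.lift (𝟙 A) (𝟙 A) rfl
  have hd1 : d ≫ pullback.fst i i = 𝟙 A := by simp [d]
  have hd2 : d ≫ pullback.snd i i = 𝟙 A := by simp [d]
  let φ : A ⟶ pullback i i := inv (coprod.desc (pullback.fst i i) (pullback.fst i j)) ≫
    coprod.desc (𝟙 _) (pullback.fst i j ≫ d)
  have h1 : pullback.fst i i ≫ φ = 𝟙 _ := by
    have : pullback.fst i i = coprod.inl ≫ coprod.desc (pullback.fst i i) (pullback.fst i j) := by
      simp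
    calc pullback.fst i i ≫ φ
        = (coprod.inl ≫ coprod.desc (pullback.fst i i) (pullback.fst i j)) ≫ φ := by rw [← this]
      _ = 𝟙 _ := by rw [Category.assoc, IsIso.hom_inv_id_assoc, coprod.inl_desc]
  have h2 : φ = d := by
    calc φ = (d ≫ pullback.fst i i) ≫ φ := by rw [hd1, Category.id_comp]
      _ = d := by rw [Category.assoc, h1, Category.comp_id]
  rw [h2] at h1
  have h3 : pullback.fst i i = pullback.snd i i := by
    calc pullback.fst i i = (pullback.fst i i) ≫ (d ≫ pullback.snd i i) := by
          rw [hd2, Category.comp_id]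
      _ = pullback.snd i i := by rw [← Category.assoc, h1, Category.id_comp]
  constructor
  intro Z k k' h
  rw [← pullback.lift_fst (f := i) (g := i) k k' h, h3, pullback.lift_snd]

/-- Any isomorphism is a Weil restriction of the identity along the identity. -/
noncomputable def isoWeil {A A' : C} (φ : A' ⟶ A) [IsIso φ] : WeilRestriction (𝟙 A) (𝟙 A) where
  R := A'
  Rq := φ
  e := pullback.fst (𝟙 A) φ
  he := by simp
  univ := by
    intro T p
    constructor
    · rintro ⟨a, ha⟩ ⟨b, hb⟩ _
      apply Subtype.ext
      exact (cancel_mono φ).1 (ha.trans hb.symm)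
    · rintro ⟨s, hs⟩
      refine ⟨⟨p ≫ inv φ, by simp⟩, ?_⟩
      apply Subtype.ext
      simp only [Category.comp_id] at hs
      simp [hs]

variable (M : NaiveTambaraFunctor C)

lemma res_res {X Y Z : C} (f : X ⟶ Y) (g : Y ⟶ Z) (a : M.obj Z) :
    M.res f (M.res g a) = M.res (f ≫ g) a := by
  rw [M.res_comp]; rfl

lemma tr_res_iso {A A' : C} (φ : A' ⟶ A) [IsIso φ] (a : M.obj A) :
    M.tr φ (M.res φ a) = a := by
  have h := M.distrib (𝟙 A) (𝟙 A) (isoWeil φ) a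
  rw [M.tr_id, M.nm_id] at h
  have h2 := M.nm_bc (𝟙 A) φ a
  rw [M.nm_id] at h2
  rw [h2]
  exact h.symm

lemma res_inj {A B P : C} (i : A ⟶ P) (j : B ⟶ P) [IsIso (coprod.desc i j)] (n n' : M.obj P)
    (h1 : M.res i n = M.res i n') (h2 : M.res j n = M.res j n') : n = n' := by
  have : M.res (coprod.desc i j) n = M.res (coprod.desc i j) n' := by
    apply (M.sheaf A B).1
    simp only [res_res, coprod.inl_desc, coprod.inr_desc, h1, h2]
  rw [← tr_res_iso M (coprod.desc i j) n, this, tr_res_iso]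

lemma tr_res_of_triv
    (hWeil : ∀ {X Y A : C} (f : X ⟶ Y) (q : A ⟶ X), Nonempty (WeilRestriction f q))
    {A B P : C} (i : A ⟶ P) (j : B ⟶ P) [IsIso (coprod.desc i j)]
    (hB : (1 : M.obj B) = 0) (n : M.obj P) : M.tr i (M.res i n) = n := by
  have := mono_coproj hWeil i j
  apply res_inj M i j
  · rw [M.tr_bc]
    have h : pullback.fst i i = pullback.snd i i := by
      rw [← cancel_mono i, pullback.condition]
    rw [h, tr_res_iso]
  · rw [← mul_one (M.res j _), ← mul_one (M.res j n), hB, mul_zero, mul_zero]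

/-- An object equalizing the two coprojections of `Y ⨿ Y` has trivial value. -/
lemma triv_of_eq {S Y : C} (y y' : S ⟶ Y)
    (h : y ≫ (coprod.inl : Y ⟶ Y ⨿ Y) = y' ≫ (coprod.inr : Y ⟶ Y ⨿ Y)) :
    (1 : M.obj S) = 0 := by
  obtain ⟨m, hm⟩ := (M.sheaf Y Y).2 (1, 0)
  have h1 := congrArg Prod.fst hm
  have h2 := congrArg Prod.snd hm
  simp only at h1 h2
  have : M.res y (M.res coprod.inl m) = M.res y' (M.res coprod.inr m) := by
    rw [res_res, res_res, h]
  rwa [h1, h2, map_one, map_zero] at this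

/-- Transfers along `q` restricted to one coprojection. -/
lemma res_tr_aux
    (hWeil : ∀ {X Y A : C} (f : X ⟶ Y) (q : A ⟶ X), Nonempty (WeilRestriction f q))
    {A B P Y Z : C} (i : A ⟶ P) (j : B ⟶ P) [IsIso (coprod.desc i j)]
    (k : Y ⟶ Z) [Mono k] (q : P ⟶ Z) (g : A ⟶ Y) (hg : i ≫ q = g ≫ k)
    (htriv : ∀ {S : C} (b : S ⟶ B) (y : S ⟶ Y), b ≫ j ≫ q = y ≫ k → (1 : M.obj S) = 0)
    (m : M.obj P) : M.res k (M.tr q m) = M.tr g (M.res i m) := by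
  rw [M.tr_bc]
  let r := pullback.fst q k
  have := univ_coprod hWeil r i j
  rw [← tr_res_of_triv M hWeil (pullback.fst r i) (pullback.fst r j)
    (htriv (pullback.snd r j) (pullback.fst r j ≫ pullback.snd q k) (by
      rw [← Category.assoc, ← pullback.condition, Category.assoc, Category.assoc,
        pullback.condition])) (M.res (pullback.fst q k) m), M.tr_comp, res_res]
  have e1 : pullback.fst r i ≫ pullback.fst q k = pullback.snd r i ≫ i := pullback.condition
  have e2 : pullback.fst r i ≫ pullback.snd q k = pullback.snd r i ≫ g := by
    rw [← cancel_mono k, Category.assoc, Category.assoc, ← hg, ← pullback.condition,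
      ← Category.assoc, e1, Category.assoc]
  have : IsIso (pullback.snd r i) := by
    refine ⟨pullback.lift (pullback.lift i g hg) (𝟙 A) (by simp [r]), ?_, by simp⟩
    apply pullback.hom_ext
    · apply pullback.hom_ext
      · simp [e1]
      · simp [e2]
    · simp
  rw [e1, e2, ← res_res, ← M.tr_comp, tr_res_iso]


end Helpers

/-- The projection formula: `tr_g (a * g^* b) = tr_g a * b`. -/
theorem projection_formula {C : Type u} [Category.{v} C] [HasPullbacks C]
    [HasFiniteCoproducts C]
    (hWeil : ∀ {X Y A : C} (f : X ⟶ Y) (q : A ⟶ X), Nonempty (WeilRestriction f q))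
    (M : NaiveTambaraFunctor C) {X Y : C} (g : X ⟶ Y)
    (a : M.obj X) (b : M.obj Y) :
    M.tr g (a * M.res g b) = M.tr g a * b := by
  classical
  let f : Y ⨿ Y ⟶ Y := coprod.desc (𝟙 Y) (𝟙 Y)
  let q : X ⨿ Y ⟶ Y ⨿ Y := coprod.map g (𝟙 Y)
  have isoXY : IsIso (coprod.desc (coprod.inl : X ⟶ X ⨿ Y) coprod.inr) := by
    rw [coprod.desc_inl_inr]; infer_instance
  have isoYX : IsIso (coprod.desc (coprod.inr : Y ⟶ X ⨿ Y) coprod.inl) := by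
    refine ⟨coprod.desc coprod.inr coprod.inl, ?_, ?_⟩ <;> ext <;> simp
  have m1 : Mono (coprod.inl : Y ⟶ Y ⨿ Y) := mono_of_mono_fac (coprod.inl_desc (𝟙 Y) (𝟙 Y))
  have m2 : Mono (coprod.inr : Y ⟶ Y ⨿ Y) := mono_of_mono_fac (coprod.inr_desc (𝟙 Y) (𝟙 Y))
  have hl : ∀ m : M.obj (X ⨿ Y), M.res coprod.inl (M.tr q m) = M.tr g (M.res coprod.inl m) := by
    intro m
    apply res_tr_aux M hWeil coprod.inl coprod.inr coprod.inl q g (by simp [q])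
    intro S b y h
    exact triv_of_eq M y b (by rw [← h]; simp [q])
  have hr : ∀ m : M.obj (X ⨿ Y), M.res coprod.inr (M.tr q m) = M.res coprod.inr m := by
    intro m
    rw [res_tr_aux M hWeil coprod.inr coprod.inl coprod.inr q (𝟙 Y) (by simp [q]) _ m, M.tr_id]
    intro S b y h
    exact triv_of_eq M (b ≫ g) y (by rw [← h]; simp [q])
  have hN : ∀ m : M.obj (X ⨿ Y),
      M.nm f (M.tr q m) = M.tr g (M.res coprod.inl m) * M.res coprod.inr m := by
    intro m
    rw [M.nm_fold, hl, hr]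
  have ex : ∀ (x : M.obj X) (y : M.obj Y), ∃ m : M.obj (X ⨿ Y),
      M.res coprod.inl m = x ∧ M.res coprod.inr m = y := by
    intro x y
    obtain ⟨m, hm⟩ := (M.sheaf X Y).2 (x, y)
    exact ⟨m, congrArg Prod.fst hm, congrArg Prod.snd hm⟩
  have exY : ∀ (x y : M.obj Y), ∃ m : M.obj (Y ⨿ Y),
      M.res coprod.inl m = x ∧ M.res coprod.inr m = y := by
    intro x y
    obtain ⟨m, hm⟩ := (M.sheaf Y Y).2 (x, y)
    exact ⟨m, congrArg Prod.fst hm, congrArg Prod.snd hm⟩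
  obtain ⟨ma, ha1, ha2⟩ := ex a 1
  obtain ⟨s, hs1, hs2⟩ := exY 1 b
  obtain ⟨t, ht1, ht2⟩ := exY b 1
  obtain ⟨W⟩ := hWeil f q
  have hq1 : (coprod.inl : X ⟶ X ⨿ Y) ≫ q = g ≫ coprod.inl := by simp [q]
  have hq2 : (coprod.inr : Y ⟶ X ⨿ Y) ≫ q = coprod.inr := by simp [q]
  have hst : M.nm f s = M.nm f t := by
    rw [M.nm_fold, M.nm_fold, hs1, hs2, ht1, ht2, mul_comm]
  have key : ∀ z : M.obj (Y ⨿ Y), M.nm f (M.tr q (ma * M.res q z)) =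
      M.tr W.Rq (M.nm (pullback.snd f W.Rq) (M.res W.e ma) * M.res W.Rq (M.nm f z)) := by
    intro z
    rw [M.distrib q f W, map_mul, map_mul, res_res, W.he, M.nm_bc f W.Rq z]
  have e := (key s).trans ((congrArg (fun w => M.tr W.Rq
    (M.nm (pullback.snd f W.Rq) (M.res W.e ma) * M.res W.Rq w)) hst).trans (key t).symm)
  rw [hN, hN] at e
  simp only [map_mul, res_res, hq1, hq2] at e
  simp only [← res_res, hs1, hs2, ht1, ht2, ha1, ha2, map_one, mul_one, one_mul] at e
  exact e.symm

end LocalSimp
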